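/- arXiv:1003.2060 — 3 statements merged into one kernel-verified Lean document; each statement's English description precedes it below -/
import Mathlib

section
/- Let σ be a real number with σ > 0 and σ ≠ 1, and let w be a positive real number. Then the Hurwitz zeta function satisfies ζ(σ, w) < (1 − σ − w) / ((1 − σ) · w^σ). -/
open Filter Topology

/-- The standard Hurwitz zeta function `ζ(s, w)` for real `w > 0`: the meromorphic continuation
of `∑_{n=0}^∞ (n + w)^{-s}`, expressed via Mathlib's (periodic in `a`) Hurwitz zeta function by
removing the first `⌈w⌉ - 1` terms of the series with parameter `w - (⌈w⌉ - 1) ∈ (0, 1]`. -/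
noncomputable def stdHurwitzZeta (s : ℂ) (w : ℝ) : ℂ :=
  HurwitzZeta.hurwitzZeta (w : UnitAddCircle) s -
    ∑ n ∈ Finset.range (⌈w⌉₊ - 1), (((n : ℝ) + (w - (⌈w⌉₊ - 1 : ℕ))) : ℂ) ^ (-s)

theorem hasSum_stdHurwitzZeta {w : ℝ} (hw : 0 < w) {s : ℂ} (hs : 1 < s.re) :
    HasSum (fun n : ℕ ↦ ((n + w : ℝ) : ℂ) ^ (-s)) (stdHurwitzZeta s w) := by
  unfold stdHurwitzZeta
  set k : ℕ := ⌈w⌉₊ - 1 with hk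
  have hpos : 1 ≤ ⌈w⌉₊ := Nat.one_le_iff_ne_zero.mpr (Nat.ceil_pos.mpr hw).ne'
  have hk' : (k : ℝ) = ⌈w⌉₊ - 1 := by rw [hk]; push_cast [hpos]; ring
  have hlt : (k : ℝ) < w := by
    rw [← Nat.lt_ceil]
    omega
  have hle : w ≤ ⌈w⌉₊ := Nat.le_ceil w
  have ha : w - k ∈ Set.Icc (0 : ℝ) 1 := ⟨by linarith, by linarith⟩
  have hcoe : ((w - k : ℝ) : UnitAddCircle) = (w : UnitAddCircle) := by
    have h0 : ((k : ℝ) : UnitAddCircle) = 0 :=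
      (AddCircle.coe_eq_zero_iff 1).mpr ⟨k, by simp⟩
    rw [AddCircle.coe_sub, h0, sub_zero]
  have h := HurwitzZeta.hasSum_hurwitzZeta_of_one_lt_re ha hs
  rw [hcoe] at h
  have h2 := (hasSum_nat_add_iff' k).mpr h
  convert! h2 using 1
  · ext n
    rw [one_div, Complex.cpow_neg]
    congr 2
    push_cast
    ring
  · congr 1
    refine Finset.sum_congr rfl fun n _ ↦ ?_
    rw [one_div, Complex.cpow_neg]
    push_cast
    rfl

theorem differentiableAt_stdHurwitzZeta {w : ℝ} (hw : 0 < w) {s : ℂ} (hs : s ≠ 1) :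
    DifferentiableAt ℂ (fun z ↦ stdHurwitzZeta z w) s := by
  unfold stdHurwitzZeta
  refine (HurwitzZeta.differentiableAt_hurwitzZeta _ hs).sub ?_
  refine DifferentiableAt.fun_sum fun n _ ↦ ?_
  refine DifferentiableAt.const_cpow (by fun_prop) (Or.inl ?_)
  have hpos : 1 ≤ ⌈w⌉₊ := Nat.one_le_iff_ne_zero.mpr (Nat.ceil_pos.mpr hw).ne'
  have hlt : ((⌈w⌉₊ - 1 : ℕ) : ℝ) < w := by
    rw [← Nat.lt_ceil]
    omega
  have : (0 : ℝ) < n + (w - (⌈w⌉₊ - 1 : ℕ)) := by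
    have : (0 : ℝ) ≤ n := n.cast_nonneg
    linarith
  exact_mod_cast this.ne'

/-- The difference between `a ^ (-s)` and `∫ x in a..a + 1, x ^ (-s)`. -/
noncomputable def hurwitzTerm (a : ℝ) (s : ℂ) : ℂ :=
  (a : ℂ) ^ (-s) - (((a + 1 : ℝ) : ℂ) ^ (1 - s) - (a : ℂ) ^ (1 - s)) / (1 - s)

theorem norm_cpow_neg_sub_le {a b : ℝ} (ha : 0 < a) (hab : a ≤ b) {s : ℂ} (hs : 0 < s.re) :
    ‖(b : ℂ) ^ (-s) - (a : ℂ) ^ (-s)‖ ≤ ‖s‖ * a ^ (-s.re - 1) * (b - a) := by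
  have hs0 : -s ≠ 0 := fun h ↦ by simp [neg_eq_zero.mp h] at hs
  refine norm_image_sub_le_of_norm_deriv_le_segment' (f := fun x : ℝ ↦ (x : ℂ) ^ (-s))
    (f' := fun x : ℝ ↦ -s * (x : ℂ) ^ (-s - 1)) (fun x hx ↦ ?_) (fun x hx ↦ ?_) b ⟨hab, le_rfl⟩
  · exact (hasDerivAt_ofReal_cpow_const (ha.trans_le hx.1).ne' hs0).hasDerivWithinAt
  · rw [norm_mul, norm_neg, Complex.norm_cpow_eq_rpow_re_of_pos (ha.trans_le hx.1)]
    simp only [Complex.sub_re, Complex.neg_re, Complex.one_re]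
    gcongr ‖s‖ * ?_
    exact Real.rpow_le_rpow_of_nonpos ha hx.1 (by linarith)

theorem norm_hurwitzTerm_le {a : ℝ} (ha : 0 < a) {s : ℂ} (hs : 0 < s.re) (hs1 : s ≠ 1) :
    ‖hurwitzTerm a s‖ ≤ ‖s‖ * a ^ (-s.re - 1) := by
  have hs1' : 1 - s ≠ 0 := sub_ne_zero.mpr hs1.symm
  have key := norm_image_sub_le_of_norm_deriv_le_segment'
    (f := fun x : ℝ ↦ (x : ℂ) * (a : ℂ) ^ (-s) - (x : ℂ) ^ (1 - s) / (1 - s))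
    (f' := fun x : ℝ ↦ (a : ℂ) ^ (-s) - (x : ℂ) ^ (-s)) (a := a) (b := a + 1)
    (C := ‖s‖ * a ^ (-s.re - 1)) (fun x hx ↦ ?_) (fun x hx ↦ ?_) (a + 1) ⟨by linarith, le_rfl⟩
  · rw [add_sub_cancel_left, mul_one] at key
    refine le_of_eq_of_le ?_ key
    congr 1
    unfold hurwitzTerm
    push_cast
    ring
  · have h1 := (hasDerivAt_ofReal_cpow_const (ha.trans_le hx.1).ne' hs1').div_const (1 - s)
    rw [mul_div_cancel_left₀ _ hs1', show 1 - s - 1 = -s by ring] at h1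
    have h2 := (Complex.ofRealCLM.hasDerivAt (x := x)).mul_const ((a : ℂ) ^ (-s))
    simp only [Complex.ofRealCLM_apply, Complex.ofReal_one, one_mul] at h2
    exact (h2.sub h1).hasDerivWithinAt
  · rw [norm_sub_rev]
    refine (norm_cpow_neg_sub_le ha hx.1 hs).trans (mul_le_of_le_one_right (by positivity) ?_)
    linarith [hx.2]

theorem rpow_neg_sub_one_le_add {a δ R x : ℝ} (ha : 0 < a) (h1 : δ ≤ x) (h2 : x ≤ R) :
    a ^ (-x - 1) ≤ a ^ (-δ - 1) + a ^ (-R - 1) := by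
  have hδ := Real.rpow_pos_of_pos ha (-δ - 1)
  have hR := Real.rpow_pos_of_pos ha (-R - 1)
  rcases le_total a 1 with h | h
  · linarith [Real.rpow_le_rpow_of_exponent_ge ha h (show -R - 1 ≤ -x - 1 by linarith)]
  · linarith [Real.rpow_le_rpow_of_exponent_le h (show -x - 1 ≤ -δ - 1 by linarith)]

theorem summable_nat_add_rpow_neg_sub_one {w p : ℝ} (hw : 0 < w) (hp : 0 < p) :
    Summable fun n : ℕ ↦ ((n : ℝ) + w) ^ (-p - 1) := by
  refine ((Real.summable_one_div_nat_add_rpow w (p + 1)).mpr (by linarith)).congr fun n ↦ ?_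
  have : (0 : ℝ) < n + w := by positivity
  rw [abs_of_pos this, show -p - 1 = -(p + 1) by ring, Real.rpow_neg this.le, one_div]

theorem summable_hurwitzTerm {w : ℝ} (hw : 0 < w) {s : ℂ} (hs : 0 < s.re) (hs1 : s ≠ 1) :
    Summable fun n : ℕ ↦ hurwitzTerm (n + w) s :=
  .of_norm_bounded ((summable_nat_add_rpow_neg_sub_one hw hs).mul_left ‖s‖) fun _ ↦
    norm_hurwitzTerm_le (by positivity) hs hs1

theorem sum_range_hurwitzTerm (w : ℝ) (s : ℂ) (N : ℕ) :
    ∑ n ∈ Finset.range N, hurwitzTerm (n + w) s =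
      ∑ n ∈ Finset.range N, ((n + w : ℝ) : ℂ) ^ (-s) -
        (((N + w : ℝ) : ℂ) ^ (1 - s) - (w : ℂ) ^ (1 - s)) / (1 - s) := by
  have h := Finset.sum_range_sub (fun n : ℕ ↦ ((n + w : ℝ) : ℂ) ^ (1 - s)) N
  simp only [Nat.cast_zero, zero_add] at h
  rw [← h, Finset.sum_div, ← Finset.sum_sub_distrib]
  refine Finset.sum_congr rfl fun n _ ↦ ?_
  unfold hurwitzTerm
  rw [show (n : ℝ) + w + 1 = ((n + 1 : ℕ) : ℝ) + w by push_cast; ring]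

theorem tendsto_nat_add_rpow_neg (w : ℝ) {p : ℝ} (hp : 0 < p) :
    Tendsto (fun n : ℕ ↦ ((n : ℝ) + w) ^ (-p)) atTop (𝓝 0) :=
  (tendsto_rpow_neg_atTop hp).comp
    (tendsto_atTop_add_const_right _ w tendsto_natCast_atTop_atTop)

theorem stdHurwitzZeta_eq_of_one_lt_re {w : ℝ} (hw : 0 < w) {s : ℂ} (hs : 1 < s.re) :
    stdHurwitzZeta s w = (w : ℂ) ^ (1 - s) / (s - 1) + ∑' n : ℕ, hurwitzTerm (n + w) s := by
  have hs1 : s ≠ 1 := fun h ↦ by simp [h] at hs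
  have hlim : Tendsto (fun N : ℕ ↦ ((N + w : ℝ) : ℂ) ^ (1 - s)) atTop (𝓝 0) := by
    rw [tendsto_zero_iff_norm_tendsto_zero]
    refine (tendsto_nat_add_rpow_neg w (sub_pos.mpr hs)).congr fun n ↦ ?_
    rw [Complex.norm_cpow_eq_rpow_re_of_pos (by positivity)]
    simp
  have h1 := (summable_hurwitzTerm hw (zero_lt_one.trans hs) hs1).hasSum.tendsto_sum_nat
  have h2 := (hasSum_stdHurwitzZeta hw hs).tendsto_sum_nat.sub
    ((hlim.sub_const ((w : ℂ) ^ (1 - s))).div_const (1 - s))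
  rw [tendsto_nhds_unique h1 (h2.congr fun N ↦ (sum_range_hurwitzTerm w s N).symm),
    ← neg_sub 1 s, div_neg]
  ring

theorem differentiableAt_hurwitzTerm {a : ℝ} (ha : 0 < a) {s : ℂ} (hs : s ≠ 1) :
    DifferentiableAt ℂ (hurwitzTerm a) s := by
  have h0 : (a : ℂ) ≠ 0 := by exact_mod_cast ha.ne'
  have h1 : ((a + 1 : ℝ) : ℂ) ≠ 0 := by exact_mod_cast (by positivity : a + 1 ≠ 0)
  unfold hurwitzTerm
  refine (DifferentiableAt.const_cpow (by fun_prop) (Or.inl h0)).sub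
    (.div (.sub ?_ ?_) (by fun_prop) (sub_ne_zero.mpr hs.symm))
  · exact .const_cpow (by fun_prop) (Or.inl h1)
  · exact .const_cpow (by fun_prop) (Or.inl h0)

theorem differentiableOn_tsum_hurwitzTerm {w δ R : ℝ} (hw : 0 < w) (hδ : 0 < δ) {U : Set ℂ}
    (hU : IsOpen U) (hU1 : 1 ∉ U) (hre : ∀ s ∈ U, δ < s.re) (hR : ∀ s ∈ U, ‖s‖ < R) :
    DifferentiableOn ℂ (fun s ↦ ∑' n : ℕ, hurwitzTerm (n + w) s) U := by
  rcases U.eq_empty_or_nonempty with rfl | ⟨z, hz⟩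
  · exact differentiableOn_empty
  have hR0 : 0 < R := (norm_nonneg z).trans_lt (hR z hz)
  refine Complex.differentiableOn_tsum_of_summable_norm
    (((summable_nat_add_rpow_neg_sub_one hw hδ).add
      (summable_nat_add_rpow_neg_sub_one hw hR0)).mul_left R)
    (fun n s hs ↦ ?_) hU (fun n s hs ↦ ?_)
  · exact (differentiableAt_hurwitzTerm (by positivity)
      (ne_of_mem_of_not_mem hs hU1)).differentiableWithinAt
  · have ha : (0 : ℝ) < n + w := by positivity
    refine (norm_hurwitzTerm_le ha (hδ.trans (hre s hs)) (ne_of_mem_of_not_mem hs hU1)).trans ?_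
    exact mul_le_mul (hR s hs).le (rpow_neg_sub_one_le_add ha (hre s hs).le
      ((Complex.re_le_norm s).trans (hR s hs).le)) (by positivity) hR0.le

theorem stdHurwitzZeta_eq {w σ : ℝ} (hw : 0 < w) (hσ : 0 < σ) (hσ1 : σ ≠ 1) :
    stdHurwitzZeta σ w =
      (w : ℂ) ^ (1 - σ : ℂ) / (σ - 1) + ∑' n : ℕ, hurwitzTerm (n + w) σ := by
  obtain ⟨δ, hδ, hδσ, hδ1⟩ : ∃ δ : ℝ, 0 < δ ∧ δ < σ ∧ δ < 1 :=
    (exists_between (lt_min hσ one_pos)).imp fun δ h ↦ ⟨h.1, lt_min_iff.mp h.2⟩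
  set V : Set ℂ := {s | δ < s.re} ∩ Metric.ball 0 (σ + 3)
  have hVo : IsOpen V :=
    (isOpen_lt continuous_const Complex.continuous_re).inter Metric.isOpen_ball
  have hVc : Convex ℝ V := (convex_halfSpace_re_gt δ).inter (convex_ball _ _)
  -- The part of `V` to the left of, above, and to the right of the pole.
  set A : Set ℂ := V ∩ {s | s.re < 1} with hA
  set B : Set ℂ := V ∩ {s | 0 < s.im} with hB
  set C : Set ℂ := V ∩ {s | 1 < s.re} with hC
  have mem_V {x : ℝ} (hx : δ < x) (hx2 : x ≤ 2) : (⟨x, 1⟩ : ℂ) ∈ V := by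
    refine ⟨hx, mem_ball_zero_iff.mpr ((Complex.norm_le_abs_re_add_abs_im _).trans_lt ?_)⟩
    simp only [abs_of_pos (hδ.trans hx), abs_one]
    linarith
  have hAB : (A ∩ B).Nonempty := by
    obtain ⟨x, hx, hx1⟩ := exists_between hδ1
    have := mem_V hx (by linarith)
    exact ⟨⟨x, 1⟩, ⟨this, hx1⟩, ⟨this, by simp⟩⟩
  have h2C : (⟨2, 1⟩ : ℂ) ∈ C := ⟨mem_V (by linarith) le_rfl, by simp⟩
  have hBC : ((A ∪ B) ∩ C).Nonempty := ⟨⟨2, 1⟩, Or.inr ⟨h2C.1, by simp⟩, h2C⟩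
  have hAo : IsOpen A := hVo.inter (isOpen_lt Complex.continuous_re continuous_const)
  have hBo : IsOpen B := hVo.inter (isOpen_lt continuous_const Complex.continuous_im)
  have hCo : IsOpen C := hVo.inter (isOpen_lt continuous_const Complex.continuous_re)
  have hUo : IsOpen (A ∪ B ∪ C) := (hAo.union hBo).union hCo
  have hUc : IsPreconnected (A ∪ B ∪ C) :=
    ((hVc.inter (convex_halfSpace_re_lt 1)).isPreconnected.union' hAB
      (hVc.inter (convex_halfSpace_im_gt 0)).isPreconnected).union' hBC
      (hVc.inter (convex_halfSpace_re_gt 1)).isPreconnected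
  have hU1 : (1 : ℂ) ∉ A ∪ B ∪ C := by simp [hA, hB, hC]
  have hUV : A ∪ B ∪ C ⊆ V :=
    Set.union_subset (Set.union_subset Set.inter_subset_left Set.inter_subset_left)
      Set.inter_subset_left
  have hf : DifferentiableOn ℂ (fun s ↦ stdHurwitzZeta s w) (A ∪ B ∪ C) := fun s hs ↦
    (differentiableAt_stdHurwitzZeta hw (ne_of_mem_of_not_mem hs hU1)).differentiableWithinAt
  have hg : DifferentiableOn ℂ (fun s ↦ (w : ℂ) ^ (1 - s) / (s - 1) +
      ∑' n : ℕ, hurwitzTerm (n + w) s) (A ∪ B ∪ C) := by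
    refine .add (fun s hs ↦ DifferentiableAt.differentiableWithinAt ?_)
      (differentiableOn_tsum_hurwitzTerm hw hδ hUo hU1 (fun s hs ↦ (hUV hs).1)
        (fun s hs ↦ mem_ball_zero_iff.mp (hUV hs).2))
    refine .div (.const_cpow (by fun_prop) (Or.inl (by exact_mod_cast hw.ne'))) (by fun_prop) ?_
    exact sub_ne_zero.mpr (ne_of_mem_of_not_mem hs hU1)
  refine (hf.analyticOnNhd hUo).eqOn_of_preconnected_of_eventuallyEq (hg.analyticOnNhd hUo) hUc
    (Or.inr h2C) ?_ (x := (σ : ℂ)) ?_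
  · filter_upwards [hCo.mem_nhds h2C] with s hs using stdHurwitzZeta_eq_of_one_lt_re hw hs.2
  · have hσV : (σ : ℂ) ∈ V := by
      refine ⟨by simpa using hδσ, mem_ball_zero_iff.mpr ?_⟩
      rw [Complex.norm_real, Real.norm_of_nonneg hσ.le]
      linarith
    rcases lt_or_gt_of_ne hσ1 with h | h
    · exact Or.inl (Or.inl ⟨hσV, by simpa using h⟩)
    · exact Or.inr ⟨hσV, by simpa using h⟩

theorem ofReal_hurwitzTerm {a : ℝ} (ha : 0 < a) (σ : ℝ) :
    hurwitzTerm a σ = ((a ^ (-σ) - ((a + 1) ^ (1 - σ) - a ^ (1 - σ)) / (1 - σ) : ℝ) : ℂ) := by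
  unfold hurwitzTerm
  push_cast [Complex.ofReal_cpow ha.le, Complex.ofReal_cpow (by positivity : 0 ≤ a + 1)]
  rfl

theorem rpow_neg_lt_slope {a σ : ℝ} (ha : 0 < a) (hσ : 0 < σ) (hσ1 : σ ≠ 1) :
    (a + 1) ^ (-σ) < ((a + 1) ^ (1 - σ) - a ^ (1 - σ)) / (1 - σ) := by
  have hder (x : ℝ) (hx : a ≤ x) :
      HasDerivAt (fun y : ℝ ↦ y ^ (1 - σ)) ((1 - σ) * x ^ (-σ)) x := by
    convert! Real.hasDerivAt_rpow_const (p := 1 - σ) (Or.inl (ha.trans_le hx).ne') using 3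
    ring
  obtain ⟨c, hc, h⟩ := exists_hasDerivAt_eq_slope (fun y : ℝ ↦ y ^ (1 - σ))
    (fun x ↦ (1 - σ) * x ^ (-σ)) (lt_add_one a)
    (fun x hx ↦ (hder x hx.1).continuousAt.continuousWithinAt) (fun x hx ↦ hder x hx.1.le)
  rw [add_sub_cancel_left, div_one] at h
  rw [← h, mul_div_cancel_left₀ _ (sub_ne_zero.mpr hσ1.symm)]
  exact Real.rpow_lt_rpow_of_neg (ha.trans hc.1) hc.2 (neg_neg_of_pos hσ)

open ComplexOrder in
/-- For real `σ > 0`, `σ ≠ 1` and real `w > 0`, the Hurwitz zeta function satisfies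
`ζ(σ, w) < (1 - σ - w) / ((1 - σ) * w ^ σ)`. -/
theorem hurwitzZeta_lt_bound (σ w : ℝ) (hσ : 0 < σ) (hσ1 : σ ≠ 1) (hw : 0 < w) :
    stdHurwitzZeta (σ : ℂ) w < (((1 - σ - w) / ((1 - σ) * w ^ σ) : ℝ) : ℂ) := by
  have hpos (n : ℕ) : (0 : ℝ) < n + w := by positivity
  have hsum := summable_hurwitzTerm hw (s := σ) (by simpa using hσ) (by exact_mod_cast hσ1)
  rw [stdHurwitzZeta_eq hw hσ hσ1]
  simp only [ofReal_hurwitzTerm (hpos _)] at hsum ⊢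
  rw [← Complex.ofReal_tsum, show (1 - σ : ℂ) = ((1 - σ : ℝ) : ℂ) by push_cast; rfl,
    show (σ - 1 : ℂ) = ((σ - 1 : ℝ) : ℂ) by push_cast; rfl, ← Complex.ofReal_cpow hw.le,
    ← Complex.ofReal_div, ← Complex.ofReal_add, Complex.real_lt_real]
  rw [Complex.summable_ofReal] at hsum
  have htel : HasSum (fun n : ℕ ↦ ((n : ℝ) + w) ^ (-σ) - (n + w + 1) ^ (-σ)) (w ^ (-σ)) := by
    rw [hasSum_iff_tendsto_nat_of_nonneg fun n ↦ sub_nonneg.mpr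
      (Real.rpow_le_rpow_of_nonpos (hpos n) (by linarith) (by linarith))]
    have h := (tendsto_nat_add_rpow_neg w hσ).const_sub (w ^ (-σ))
    rw [sub_zero] at h
    refine h.congr fun N ↦ ?_
    have h' := Finset.sum_range_sub' (fun n : ℕ ↦ ((n : ℝ) + w) ^ (-σ)) N
    simp only [Nat.cast_zero, zero_add, Nat.cast_add, Nat.cast_one, add_right_comm _ (1 : ℝ)] at h'
    exact h'.symm
  have hlt (n : ℕ) := sub_lt_sub_left (rpow_neg_lt_slope (hpos n) hσ hσ1) ((n + w) ^ (-σ))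
  have key := hsum.tsum_lt_tsum (fun n ↦ (hlt n).le) (hlt 0) htel.summable
  rw [htel.tsum_eq] at key
  refine (add_lt_add_right key _).trans_eq ?_
  have h1 : 1 - σ ≠ 0 := sub_ne_zero.mpr hσ1.symm
  have h2 : σ - 1 ≠ 0 := sub_ne_zero.mpr hσ1
  have h3 : w ^ σ ≠ 0 := (Real.rpow_pos_of_pos hw σ).ne'
  rw [Real.rpow_sub hw, Real.rpow_one, Real.rpow_neg hw.le]
  field_simp
  ring
end

section
/- For every real number σ with 0 < σ < 1, the Riemann zeta function is negative at σ: ζ(σ) < 0. -/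
open Set Filter MeasureTheory in
/-- The Mellin transform of the fractional part, cut off to `(1, ∞)`, is holomorphic in the left
half-plane. -/
lemma differentiableAt_mellin_indicator_fract {s : ℂ} (hs : s.re < 0) :
    DifferentiableAt ℂ
      (mellin ((Ioi (1 : ℝ)).indicator fun t ↦ ((Int.fract t : ℝ) : ℂ))) s := by
  have h_bound (t : ℝ) :
      ‖(Ioi (1 : ℝ)).indicator (fun t ↦ ((Int.fract t : ℝ) : ℂ)) t‖ ≤ 1 := by
    refine (norm_indicator_le_norm_self _ _).trans ?_
    rw [Complex.norm_real, Real.norm_of_nonneg (Int.fract_nonneg t)]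
    exact (Int.fract_lt_one t).le
  have h_meas : Measurable ((Ioi (1 : ℝ)).indicator fun t ↦ ((Int.fract t : ℝ) : ℂ)) :=
    (Complex.measurable_ofReal.comp measurable_fract).indicator measurableSet_Ioi
  refine mellin_differentiableAt_of_isBigO_rpow (a := 0) (b := s.re - 1) ?_ ?_ hs ?_ (by linarith)
  · refine LocallyIntegrable.locallyIntegrableOn ?_ _
    exact (locallyIntegrable_const (1 : ℝ)).mono h_meas.aestronglyMeasurable
      (.of_forall fun t ↦ by simpa using h_bound t)
  · exact Asymptotics.IsBigO.of_bound 1 (.of_forall fun t ↦ by simpa using h_bound t)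
  · refine (Asymptotics.isBigO_zero _ _).congr' ?_ .rfl
    filter_upwards [mem_nhdsWithin_of_mem_nhds (Iio_mem_nhds zero_lt_one)] with t ht
    exact (indicator_of_notMem (notMem_Ioi.mpr (le_of_lt ht)) _).symm

open Set MeasureTheory in
lemma mellin_indicator_fract (s : ℂ) :
    mellin ((Ioi (1 : ℝ)).indicator fun t ↦ ((Int.fract t : ℝ) : ℂ)) (-s) =
      ∫ t in Ioi (1 : ℝ), ((Int.fract t : ℝ) : ℂ) * (t : ℂ) ^ (-s - 1) := by
  have h (t : ℝ) : (t : ℂ) ^ (-s - 1) •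
      (Ioi (1 : ℝ)).indicator (fun t ↦ ((Int.fract t : ℝ) : ℂ)) t =
      (Ioi (1 : ℝ)).indicator (fun t ↦ ((Int.fract t : ℝ) : ℂ) * (t : ℂ) ^ (-s - 1)) t := by
    by_cases ht : t ∈ Ioi (1 : ℝ) <;> simp [ht, mul_comm]
  simp_rw [mellin, h]
  rw [setIntegral_indicator measurableSet_Ioi,
    inter_eq_right.mpr (Ioi_subset_Ioi zero_le_one)]

open Set MeasureTheory in
/-- Abel summation for the Dirichlet series of `riemannZeta`. -/
lemma riemannZeta_eq_sub_integral_fract_of_one_lt_re {s : ℂ} (hs : 1 < s.re) :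
    riemannZeta s = s / (s - 1) -
      s * ∫ t in Ioi (1 : ℝ), ((Int.fract t : ℝ) : ℂ) * (t : ℂ) ^ (-s - 1) := by
  have h_re : (-s).re < -1 := by simpa using hs
  have h_re' : (-s - 1).re < -1 := by
    rw [Complex.sub_re, Complex.neg_re, Complex.one_re]; linarith
  have h_ne : s - 1 ≠ 0 := fun h ↦ by
    rw [sub_eq_zero.mp h] at hs; simp at hs
  have h_int := integrableOn_Ioi_cpow_of_lt h_re zero_lt_one
  have h_fract : IntegrableOn
      (fun t : ℝ ↦ ((Int.fract t : ℝ) : ℂ) * (t : ℂ) ^ (-s - 1)) (Ioi 1) := by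
    refine (integrableOn_Ioi_cpow_of_lt h_re' zero_lt_one).bdd_mul (c := 1)
      (Complex.measurable_ofReal.comp measurable_fract).aestronglyMeasurable
      (.of_forall fun t ↦ ?_)
    rw [Complex.norm_real, Real.norm_of_nonneg (Int.fract_nonneg t)]
    exact (Int.fract_lt_one t).le
  have h_sum : LSeries 1 s =
      s * ∫ t in Ioi (1 : ℝ), (∑ k ∈ Finset.Icc 1 ⌊t⌋₊, (1 : ℕ → ℂ) k) * t ^ (-(s + 1)) := by
    refine LSeries_eq_mul_integral' _ zero_le_one hs ?_
    simpa using Asymptotics.isBigO_refl _ _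
  have h_split : ∫ t in Ioi (1 : ℝ), (∑ k ∈ Finset.Icc 1 ⌊t⌋₊, (1 : ℕ → ℂ) k) * t ^ (-(s + 1)) =
      ∫ t in Ioi (1 : ℝ), ((t : ℂ) ^ (-s) - ((Int.fract t : ℝ) : ℂ) * (t : ℂ) ^ (-s - 1)) := by
    refine setIntegral_congr_fun measurableSet_Ioi fun t ht ↦ ?_
    have ht0 : 0 < t := zero_lt_one.trans ht
    have h_pow : (t : ℂ) ^ (-s) = t * (t : ℂ) ^ (-s - 1) := by
      rw [Complex.cpow_sub _ _ (by exact_mod_cast ht0.ne'), Complex.cpow_one,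
        mul_div_cancel₀ _ (by exact_mod_cast ht0.ne')]
    have h_floor : (⌊t⌋₊ : ℂ) = t - ((Int.fract t : ℝ) : ℂ) := by
      rw [← Complex.ofReal_sub, Int.self_sub_fract, ← natCast_floor_eq_intCast_floor ht0.le]
      simp
    simp only [Pi.one_apply, Finset.sum_const, Nat.card_Icc, add_tsub_cancel_right, nsmul_eq_mul,
      mul_one]
    rw [h_floor, h_pow, neg_add']
    ring
  rw [← LSeries_one_eq_riemannZeta hs, h_sum, h_split, integral_sub h_int h_fract,
    integral_Ioi_cpow_of_lt h_re zero_lt_one, Complex.ofReal_one, Complex.one_cpow,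
    show -s + 1 = -(s - 1) by ring]
  field_simp

open Set Filter MeasureTheory Topology in
/-- The integral representation of `riemannZeta` in the half-plane `0 < s.re`. -/
lemma riemannZeta_eq_sub_integral_fract {s : ℂ} (hs : 0 < s.re) (hs1 : s ≠ 1) :
    riemannZeta s = s / (s - 1) -
      s * ∫ t in Ioi (1 : ℝ), ((Int.fract t : ℝ) : ℂ) * (t : ℂ) ^ (-s - 1) := by
  set F : ℂ → ℂ := mellin ((Ioi (1 : ℝ)).indicator fun t ↦ ((Int.fract t : ℝ) : ℂ)) with hF
  have h_open : IsOpen {z : ℂ | 0 < z.re} := isOpen_lt continuous_const Complex.continuous_re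
  have h_diff : DifferentiableOn ℂ (fun z ↦ z - (z - 1) * (z * F (-z))) {z : ℂ | 0 < z.re} := by
    intro z hz
    have hFz : DifferentiableAt ℂ (fun z ↦ F (-z)) z :=
      (differentiableAt_mellin_indicator_fract (s := -z) (by simpa using hz)).comp z
        differentiableAt_id.neg
    exact (differentiableAt_id.sub ((differentiableAt_id.sub_const 1).mul
      (differentiableAt_id.mul hFz))).differentiableWithinAt
  have h_eq : EqOn riemannZeta₁ (fun z ↦ z - (z - 1) * (z * F (-z))) {z : ℂ | 0 < z.re} := by
    refine AnalyticOnNhd.eqOn_of_preconnected_of_eventuallyEq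
      (differentiable_riemannZeta₁.differentiableOn.analyticOnNhd h_open)
      (h_diff.analyticOnNhd h_open) (convex_halfSpace_re_gt 0).isPreconnected
      (z₀ := 2) (by simp) ?_
    have h_nhds : {z : ℂ | 1 < z.re} ∈ 𝓝 (2 : ℂ) :=
      (isOpen_lt continuous_const Complex.continuous_re).mem_nhds (by simp)
    filter_upwards [h_nhds] with z hz
    have hz1 : z ≠ 1 := fun h ↦ by simp [h] at hz
    have hz2 : z - 1 ≠ 0 := sub_ne_zero.mpr hz1
    have h := riemannZeta_eq_inv_sub_mul hz1
    rw [riemannZeta_eq_sub_integral_fract_of_one_lt_re hz, ← mellin_indicator_fract, ← hF] at h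
    field_simp at h
    linear_combination -h
  have hs2 : s - 1 ≠ 0 := sub_ne_zero.mpr hs1
  rw [riemannZeta_eq_inv_sub_mul hs1, h_eq hs, ← mellin_indicator_fract, ← hF]
  field_simp

open ComplexOrder in
/-- The Riemann zeta function is negative on the real interval `(0, 1)`. -/
theorem riemannZeta_neg_of_mem_Ioo (σ : ℝ) (hσ0 : 0 < σ) (hσ1 : σ < 1) :
    riemannZeta (σ : ℂ) < 0 := by
  have h_int : ∫ t in Set.Ioi (1 : ℝ), ((Int.fract t : ℝ) : ℂ) * (t : ℂ) ^ (-(σ : ℂ) - 1) =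
      ((∫ t in Set.Ioi (1 : ℝ), Int.fract t * t ^ (-σ - 1) : ℝ) : ℂ) := by
    rw [← integral_complex_ofReal]
    refine MeasureTheory.setIntegral_congr_fun measurableSet_Ioi fun t ht ↦ ?_
    have ht0 : 0 ≤ t := zero_le_one.trans (le_of_lt ht)
    simp [Complex.ofReal_cpow ht0]
  have h_nonneg : 0 ≤ ∫ t in Set.Ioi (1 : ℝ), Int.fract t * t ^ (-σ - 1) :=
    MeasureTheory.setIntegral_nonneg measurableSet_Ioi fun t ht ↦
      mul_nonneg (Int.fract_nonneg t) (Real.rpow_nonneg (zero_le_one.trans (le_of_lt ht)) _)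
  have h_pole : σ / (σ - 1) < 0 := div_neg_of_pos_of_neg hσ0 (by linarith)
  rw [riemannZeta_eq_sub_integral_fract (by simpa using hσ0) (by exact_mod_cast hσ1.ne), h_int]
  have h_neg : σ / (σ - 1) - σ * ∫ t in Set.Ioi (1 : ℝ), Int.fract t * t ^ (-σ - 1) < 0 := by
    linarith [mul_nonneg hσ0.le h_nonneg]
  exact_mod_cast h_neg
end

section
/- Let s be a complex number with Re(s) > 0 and s ≠ 1, and let w be a positive real number. Then ζ(s, w) = lim_{N→∞} ( ∑_{n=0}^{N} (n + w)^{−s} − (N + w)^{1−s} / (1 − s) ). -/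
open Filter Topology

namespace HurwitzZetaLimit

/-- The truncated Hurwitz sum minus the corresponding integral term. -/
noncomputable def regularizedSum (s : ℂ) (w : ℝ) (N : ℕ) : ℂ :=
  (∑ n ∈ Finset.range (N + 1), ((n : ℂ) + w) ^ (-s)) - ((N : ℂ) + w) ^ (1 - s) / (1 - s)

/-- The increment of `(1 - s) * regularizedSum s w N` from `N = n` to `N = n + 1`. -/
noncomputable def increment (w : ℝ) (n : ℕ) (s : ℂ) : ℂ :=
  (1 - s) * (((n + w + 1 : ℝ) : ℂ) ^ (-s)) -
    (((n + w + 1 : ℝ) : ℂ) ^ (1 - s) - ((n + w : ℝ) : ℂ) ^ (1 - s))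

lemma one_sub_mul_regularizedSum {s : ℂ} (hs : s ≠ 1) (w : ℝ) (N : ℕ) :
    (1 - s) * regularizedSum s w N =
      ((1 - s) * (w : ℂ) ^ (-s) - (w : ℂ) ^ (1 - s)) +
        ∑ n ∈ Finset.range N, increment w n s := by
  have h1 : 1 - s ≠ 0 := sub_ne_zero.mpr hs.symm
  have key (M : ℕ) : (1 - s) * regularizedSum s w M =
      (1 - s) * (∑ n ∈ Finset.range (M + 1), ((n : ℂ) + w) ^ (-s)) -
        ((M : ℂ) + w) ^ (1 - s) := by
    rw [regularizedSum, mul_sub, mul_div_cancel₀ _ h1]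
  induction N with
  | zero => simp [key]
  | succ N ih =>
    rw [key] at ih ⊢
    rw [Finset.sum_range_succ, mul_add, Finset.sum_range_succ (fun n ↦ increment w n s),
      ← add_assoc, ← ih, increment]
    push_cast
    rw [show (N : ℂ) + w + 1 = N + 1 + w by ring]
    ring

lemma norm_cpow_sub_cpow_le {s : ℂ} (hs : 0 < s.re) {p x : ℝ} (hp : 0 < p)
    (hx : x ∈ Set.Icc p (p + 1)) :
    ‖(x : ℂ) ^ (-s) - ((p + 1 : ℝ) : ℂ) ^ (-s)‖ ≤ ‖s‖ * p ^ (-(s.re + 1)) := by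
  have hs0 : -s ≠ 0 := by
    rintro h
    simp [neg_eq_zero.mp h] at hs
  have hC : 0 ≤ ‖s‖ * p ^ (-(s.re + 1)) := by positivity
  have := Convex.norm_image_sub_le_of_norm_hasDerivWithin_le
    (f := fun y : ℝ ↦ (y : ℂ) ^ (-s)) (s := Set.Icc p (p + 1))
    (C := ‖s‖ * p ^ (-(s.re + 1)))
    (fun y hy ↦ (hasDerivAt_ofReal_cpow_const (hp.trans_le hy.1).ne' hs0).hasDerivWithinAt)
    (fun y hy ↦ ?_) (convex_Icc _ _) (Set.right_mem_Icc.mpr (by linarith)) hx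
  · refine this.trans (mul_le_of_le_one_right hC ?_)
    rw [Real.norm_eq_abs, abs_le]
    constructor <;> linarith [hx.1, hx.2]
  · rw [norm_mul, norm_neg, Complex.norm_cpow_eq_rpow_re_of_pos (hp.trans_le hy.1)]
    gcongr
    rw [show (-s - 1).re = -(s.re + 1) by simp; ring]
    exact Real.rpow_le_rpow_of_nonpos hp hy.1 (by linarith)

lemma norm_increment_le {s : ℂ} (hs : 0 < s.re) {w : ℝ} (hw : 0 < w) (n : ℕ) :
    ‖increment w n s‖ ≤ ‖1 - s‖ * (‖s‖ * (n + w) ^ (-(s.re + 1))) := by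
  rcases eq_or_ne s 1 with rfl | hs1
  · simp [increment]
  have h1 : 1 - s ≠ 0 := sub_ne_zero.mpr hs1.symm
  have hp : 0 < n + w := by positivity
  set p : ℝ := n + w
  have hder (y : ℝ) (hy : y ∈ Set.Icc p (p + 1)) :
      HasDerivWithinAt (fun y : ℝ ↦ (y : ℂ) ^ (1 - s) - (1 - s) * ((p + 1 : ℝ) : ℂ) ^ (-s) * y)
        ((1 - s) * ((y : ℂ) ^ (-s) - ((p + 1 : ℝ) : ℂ) ^ (-s))) (Set.Icc p (p + 1)) y := by
    have hd := (hasDerivAt_ofReal_cpow_const (hp.trans_le hy.1).ne' h1).sub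
      ((Complex.ofRealCLM.hasDerivAt (x := y)).const_mul ((1 - s) * ((p + 1 : ℝ) : ℂ) ^ (-s)))
    convert! hd.hasDerivWithinAt using 1
    rw [show 1 - s - 1 = -s by ring, Complex.ofRealCLM_apply, Complex.ofReal_one]
    ring
  have := Convex.norm_image_sub_le_of_norm_hasDerivWithin_le hder
    (C := ‖1 - s‖ * (‖s‖ * p ^ (-(s.re + 1))))
    (fun y hy ↦ by rw [norm_mul]; gcongr; exact norm_cpow_sub_cpow_le hs hp hy)
    (convex_Icc _ _) (Set.right_mem_Icc.mpr (by linarith)) (Set.left_mem_Icc.mpr (by linarith))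
  convert! this using 1
  · congr 1
    rw [increment, Complex.ofReal_add p 1, Complex.ofReal_one]
    ring
  · simp

lemma differentiable_const_cpow_comp {x : ℝ} (hx : 0 < x) {f : ℂ → ℂ} (hf : Differentiable ℂ f) :
    Differentiable ℂ fun s ↦ (x : ℂ) ^ f s :=
  fun s ↦ (hf s).const_cpow (.inl (mod_cast hx.ne'))

lemma differentiable_increment {w : ℝ} (hw : 0 < w) (n : ℕ) :
    Differentiable ℂ (increment w n) := by
  have h0 : 0 < n + w := by positivity
  have h1 : 0 < n + w + 1 := by positivity
  have hs : Differentiable ℂ fun s : ℂ ↦ 1 - s := by fun_prop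
  exact (hs.mul (differentiable_const_cpow_comp h1 differentiable_neg)).sub
    ((differentiable_const_cpow_comp h1 hs).sub (differentiable_const_cpow_comp h0 hs))

/-- A bounded part of a right half-plane. -/
def region (ε R : ℝ) : Set ℂ := {s | ε < s.re} ∩ Metric.ball 0 R

lemma mem_region {ε R : ℝ} {s : ℂ} : s ∈ region ε R ↔ ε < s.re ∧ ‖s‖ < R := by
  simp [region]

lemma isOpen_region (ε R : ℝ) : IsOpen (region ε R) :=
  (isOpen_lt continuous_const Complex.continuous_re).inter Metric.isOpen_ball

lemma isPreconnected_region (ε R : ℝ) : IsPreconnected (region ε R) :=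
  ((convex_halfSpace_re_gt ε).inter (convex_ball 0 R)).isPreconnected

lemma norm_increment_le_of_mem_region {ε R : ℝ} (hε : 0 < ε) {w : ℝ} (hw : 1 ≤ w) (n : ℕ)
    {s : ℂ} (hs : s ∈ region ε R) :
    ‖increment w n s‖ ≤ (1 + R) * (R * ((n + 1 : ℕ) : ℝ) ^ (-(ε + 1))) := by
  obtain ⟨hre, hR⟩ := mem_region.mp hs
  have hR0 : 0 < R := (norm_nonneg s).trans_lt hR
  refine (norm_increment_le (hε.trans hre) (by linarith) n).trans ?_
  have h1 : ‖1 - s‖ ≤ 1 + R := (norm_sub_le _ _).trans (by rw [norm_one]; linarith)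
  gcongr
  calc (n + w) ^ (-(s.re + 1)) ≤ ((n + 1 : ℕ) : ℝ) ^ (-(s.re + 1)) :=
        Real.rpow_le_rpow_of_nonpos (by positivity) (by push_cast; linarith) (by linarith)
    _ ≤ ((n + 1 : ℕ) : ℝ) ^ (-(ε + 1)) :=
        Real.rpow_le_rpow_of_exponent_le (by simp) (by linarith)

lemma summable_increment_bound {ε : ℝ} (hε : 0 < ε) (R : ℝ) :
    Summable fun n : ℕ ↦ (1 + R) * (R * ((n + 1 : ℕ) : ℝ) ^ (-(ε + 1))) :=
  (((summable_nat_add_iff 1).mpr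
    (Real.summable_nat_rpow.mpr (by linarith : -(ε + 1) < -1))).mul_left R).mul_left _

/-- The limit of `(1 - s) * regularizedSum s w N` as `N → ∞`. -/
noncomputable def limitFun (w : ℝ) (s : ℂ) : ℂ :=
  ((1 - s) * (w : ℂ) ^ (-s) - (w : ℂ) ^ (1 - s)) + ∑' n, increment w n s

lemma differentiableOn_limitFun {ε R : ℝ} (hε : 0 < ε) {w : ℝ} (hw : 1 ≤ w) :
    DifferentiableOn ℂ (limitFun w) (region ε R) := by
  have hw0 : 0 < w := by linarith
  have hs : Differentiable ℂ fun s : ℂ ↦ 1 - s := by fun_prop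
  exact ((hs.mul (differentiable_const_cpow_comp hw0 differentiable_neg)).sub
    (differentiable_const_cpow_comp hw0 hs)).differentiableOn.add
    (Complex.differentiableOn_tsum_of_summable_norm (summable_increment_bound hε R)
      (fun n ↦ (differentiable_increment hw0 n).differentiableOn) (isOpen_region ε R)
      fun n _ hs ↦ norm_increment_le_of_mem_region hε hw n hs)

lemma exists_mem_region {s : ℂ} (hs : 0 < s.re) :
    ∃ ε R : ℝ, 0 < ε ∧ s ∈ region ε R ∧ (2 : ℂ) ∈ region ε R := by
  refine ⟨min (s.re / 2) 1, max (‖s‖ + 1) 3, by positivity, mem_region.mpr ⟨?_, ?_⟩,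
    mem_region.mpr ⟨?_, ?_⟩⟩
  · exact (min_le_left _ _).trans_lt (by linarith)
  · exact (lt_add_one _).trans_le (le_max_left _ _)
  · exact (min_le_right _ _).trans_lt (by norm_num)
  · exact (by norm_num : ‖(2 : ℂ)‖ < 3).trans_le (le_max_right _ _)

lemma tendsto_one_sub_mul_regularizedSum {s : ℂ} (hs : 0 < s.re) (hs1 : s ≠ 1) {w : ℝ}
    (hw : 1 ≤ w) :
    Tendsto (fun N ↦ (1 - s) * regularizedSum s w N) atTop (𝓝 (limitFun w s)) := by
  obtain ⟨ε, R, hε, hsR, -⟩ := exists_mem_region hs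
  simp_rw [one_sub_mul_regularizedSum hs1]
  exact ((Summable.of_norm_bounded (summable_increment_bound hε R)
    fun n ↦ norm_increment_le_of_mem_region hε hw n hsR).hasSum.tendsto_sum_nat).const_add _

lemma tendsto_regularizedSum_of_one_lt_re {s : ℂ} (hs : 1 < s.re) {a : ℝ}
    (ha : a ∈ Set.Icc (0 : ℝ) 1) :
    Tendsto (regularizedSum s (a + 1)) atTop
      (𝓝 (HurwitzZeta.hurwitzZeta a s - (a : ℂ) ^ (-s))) := by
  have hsum := (hasSum_nat_add_iff' 1).mpr (HurwitzZeta.hasSum_hurwitzZeta_of_one_lt_re ha hs)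
  have hlim := hsum.tendsto_sum_nat.comp (tendsto_add_atTop_nat 1)
  have hpow : Tendsto (fun N : ℕ ↦ ((N : ℂ) + (a + 1 : ℝ)) ^ (1 - s)) atTop (𝓝 0) := by
    rw [tendsto_zero_iff_norm_tendsto_zero]
    have hreal := (tendsto_rpow_neg_atTop (by linarith : 0 < s.re - 1)).comp
      (tendsto_atTop_add_const_right atTop (a + 1) tendsto_natCast_atTop_atTop)
    refine hreal.congr fun N ↦ ?_
    have hpos : 0 < (N : ℝ) + (a + 1) := by linarith [ha.1, N.cast_nonneg (α := ℝ)]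
    rw [← Complex.ofReal_natCast, ← Complex.ofReal_add,
      Complex.norm_cpow_eq_rpow_re_of_pos hpos]
    simp
  have := hlim.sub (hpow.div_const (1 - s))
  simp only [Finset.range_one, Finset.sum_singleton, Nat.cast_zero, zero_add, zero_div,
    sub_zero, one_div, ← Complex.cpow_neg] at this
  refine this.congr fun N ↦ ?_
  simp only [regularizedSum, Function.comp_apply]
  congr 1
  refine Finset.sum_congr rfl fun n _ ↦ ?_
  push_cast
  congr 1
  ring

/-- The analytic continuation of `(1 - s) * (hurwitzZeta a s - a ^ (-s))` across `s = 1`. -/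
noncomputable def continuedZeta (a : ℝ) (s : ℂ) : ℂ :=
  (1 - s) * (HurwitzZeta.hurwitzZeta a s - 1 / (s - 1) / s.Gammaℝ) - s.Gammaℝ⁻¹ -
    (1 - s) * (a : ℂ) ^ (-s)

lemma continuedZeta_eq {a : ℝ} {s : ℂ} (hs1 : s ≠ 1) :
    continuedZeta a s = (1 - s) * (HurwitzZeta.hurwitzZeta a s - (a : ℂ) ^ (-s)) := by
  have : s - 1 ≠ 0 := sub_ne_zero.mpr hs1
  have h : (1 - s) * (1 / (s - 1) / s.Gammaℝ) = -s.Gammaℝ⁻¹ := by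
    rw [← neg_sub s 1, neg_mul, one_div, div_eq_mul_inv, mul_inv_cancel_left₀ this]
  rw [continuedZeta, mul_sub, h]
  ring

lemma differentiable_continuedZeta {a : ℝ} (ha : 0 < a) :
    Differentiable ℂ (continuedZeta a) := by
  intro s
  have hcpow := differentiable_const_cpow_comp ha differentiable_neg
  have hs : Differentiable ℂ fun s : ℂ ↦ 1 - s := by fun_prop
  rcases eq_or_ne s 1 with rfl | hs1
  · exact (((hs 1).mul (HurwitzZeta.differentiableAt_hurwitzZeta_sub_one_div a)).sub
      (Complex.differentiable_Gammaℝ_inv 1)).sub ((hs 1).mul (hcpow 1))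
  · have h := (hs s).mul ((HurwitzZeta.differentiableAt_hurwitzZeta a hs1).sub (hcpow s))
    refine h.congr_of_eventuallyEq ?_
    filter_upwards [isOpen_ne.mem_nhds hs1] with z hz using continuedZeta_eq hz

lemma limitFun_eq_continuedZeta {s : ℂ} (hs : 0 < s.re) {a : ℝ} (ha : a ∈ Set.Ioc (0 : ℝ) 1) :
    limitFun (a + 1) s = continuedZeta a s := by
  obtain ⟨ε, R, hε, hsR, h2R⟩ := exists_mem_region hs
  have hw : 1 ≤ a + 1 := by linarith [ha.1]
  refine ((differentiableOn_limitFun hε hw).analyticOnNhd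
    (isOpen_region ε R)).eqOn_of_preconnected_of_eventuallyEq
    ((differentiable_continuedZeta ha.1).differentiableOn.analyticOnNhd (isOpen_region ε R))
    (isPreconnected_region ε R) h2R ?_ hsR
  have hmem : ∀ᶠ z : ℂ in 𝓝 2, 1 < z.re :=
    continuousAt_const.eventually_lt Complex.continuous_re.continuousAt (by simp)
  filter_upwards [hmem] with z hz
  have hz1 : z ≠ 1 := by
    rintro rfl
    simp at hz
  rw [continuedZeta_eq hz1]
  exact tendsto_nhds_unique
    (tendsto_one_sub_mul_regularizedSum (zero_lt_one.trans hz) hz1 hw)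
    ((tendsto_regularizedSum_of_one_lt_re hz ⟨ha.1.le, ha.2⟩).const_mul _)

lemma regularizedSum_succ (s : ℂ) (w : ℝ) (N : ℕ) :
    regularizedSum s w (N + 1) = (w : ℂ) ^ (-s) + regularizedSum s (w + 1) N := by
  rw [regularizedSum, regularizedSum, Finset.sum_range_succ']
  push_cast
  simp only [add_assoc, add_comm (1 : ℂ), zero_add]
  ring

lemma tendsto_regularizedSum_add_one_iff {s L : ℂ} {w : ℝ} :
    Tendsto (regularizedSum s (w + 1)) atTop (𝓝 (L - (w : ℂ) ^ (-s))) ↔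
      Tendsto (regularizedSum s w) atTop (𝓝 L) := by
  rw [← tendsto_add_atTop_iff_nat (f := regularizedSum s w) 1]
  simp_rw [regularizedSum_succ]
  constructor <;> intro h
  · simpa using h.const_add ((w : ℂ) ^ (-s))
  · simpa using h.sub_const ((w : ℂ) ^ (-s))

lemma tendsto_regularizedSum_of_mem_Ioc {s : ℂ} (hs : 0 < s.re) (hs1 : s ≠ 1) {a : ℝ}
    (ha : a ∈ Set.Ioc (0 : ℝ) 1) :
    Tendsto (regularizedSum s a) atTop (𝓝 (HurwitzZeta.hurwitzZeta a s)) := by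
  have h1 : 1 - s ≠ 0 := sub_ne_zero.mpr hs1.symm
  have h := (tendsto_one_sub_mul_regularizedSum hs hs1 (w := a + 1)
    (by linarith [ha.1])).const_mul (1 - s)⁻¹
  rw [limitFun_eq_continuedZeta hs ha, continuedZeta_eq hs1] at h
  simp only [inv_mul_cancel_left₀ h1] at h
  exact tendsto_regularizedSum_add_one_iff.mp h

lemma tendsto_regularizedSum_add_nat {s : ℂ} (hs : 0 < s.re) (hs1 : s ≠ 1) {a : ℝ}
    (ha : a ∈ Set.Ioc (0 : ℝ) 1) (k : ℕ) :
    Tendsto (regularizedSum s (a + k)) atTop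
      (𝓝 (HurwitzZeta.hurwitzZeta a s - ∑ n ∈ Finset.range k, ((n : ℂ) + a) ^ (-s))) := by
  induction k with
  | zero => simpa using tendsto_regularizedSum_of_mem_Ioc hs hs1 ha
  | succ k ih =>
    have h := tendsto_regularizedSum_add_one_iff.mpr ih
    rw [Complex.ofReal_add, Complex.ofReal_natCast, add_comm (a : ℂ)] at h
    rwa [Finset.sum_range_succ, ← sub_sub, Nat.cast_succ, ← add_assoc]

end HurwitzZetaLimit

/-- For complex `s` with `Re s > 0`, `s ≠ 1`, and real `w > 0`,
`ζ(s, w) = lim_{N → ∞} (∑_{n=0}^{N} (n + w)^{-s} - (N + w)^{1-s} / (1 - s))`. -/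
theorem hurwitzZeta_eq_lim (s : ℂ) (hs : 0 < s.re) (hs1 : s ≠ 1) (w : ℝ) (hw : 0 < w) :
    Tendsto (fun N : ℕ =>
        (∑ n ∈ Finset.range (N + 1), ((((n : ℝ) + w) : ℂ) ^ (-s)))
          - (((N : ℝ) + w) : ℂ) ^ (1 - s) / (1 - s))
      atTop (𝓝 (stdHurwitzZeta s w)) := by
  have hceil : ((⌈w⌉₊ - 1 : ℕ) : ℝ) = ⌈w⌉₊ - 1 := by
    rw [Nat.cast_sub (Nat.one_le_ceil_iff.mpr hw), Nat.cast_one]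
  have ha : w - (⌈w⌉₊ - 1 : ℕ) ∈ Set.Ioc (0 : ℝ) 1 := by
    rw [hceil]
    constructor <;> linarith [Nat.ceil_lt_add_one hw.le, Nat.le_ceil w]
  have hcircle : ((w - (⌈w⌉₊ - 1 : ℕ) : ℝ) : UnitAddCircle) = w := by
    rw [AddCircle.coe_sub, sub_eq_self, AddCircle.coe_eq_zero_iff]
    exact ⟨(⌈w⌉₊ - 1 : ℕ), by simp⟩
  have h := HurwitzZetaLimit.tendsto_regularizedSum_add_nat hs hs1 ha (⌈w⌉₊ - 1)
  rw [hcircle, sub_add_cancel] at h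
  refine Tendsto.congr (fun N ↦ ?_) (?_ : Tendsto (HurwitzZetaLimit.regularizedSum s w) _ _)
  · simp [HurwitzZetaLimit.regularizedSum]
  · simpa [stdHurwitzZeta] using h
end
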